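/- For every real θ, the coverage probability C(θ) = ∫₀^∞ ∫_ℝ 1{g(u,w) − w·s(|u|/w) ≤ θ ≤ g(u,w) + w·s(|u|/w)}·φ(u−θ)·f_W(w) du dw satisfies C(θ) = ∫_{−k}^{k} ∫₀^∞ 1{h(x) − s(|x|) ≤ θ/w ≤ h(x) + s(|x|)}·φ(wx − θ)·w·f_W(w) dw dx + (1 − α) − ∫₀^∞ b(w; m, k, θ)·f_W(w) dw. -/

import Mathlib

open Real MeasureTheory Set Filter

/-- Standard normal probability density function. -/
noncomputable def phi (x : ℝ) : ℝ := (Real.sqrt (2 * Real.pi))⁻¹ * Real.exp (-x ^ 2 / 2)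

/-- Standard normal cumulative distribution function. -/
noncomputable def Phi (x : ℝ) : ℝ := ∫ u in Set.Iic x, phi u

/-- Density of W = sqrt(Q/m), Q ~ chi-squared with m degrees of freedom. -/
noncomputable def fW (m : ℕ) (w : ℝ) : ℝ :=
  (2 * (m : ℝ) ^ ((m : ℝ) / 2) / (Real.Gamma ((m : ℝ) / 2) * (2 : ℝ) ^ ((m : ℝ) / 2)))
    * w ^ ((m : ℝ) - 1) * Real.exp (-(m : ℝ) * w ^ 2 / 2)

/-- E(W). -/
noncomputable def EW (m : ℕ) : ℝ := ∫ w in Set.Ioi (0 : ℝ), w * fW m w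

/-- The SCAD map with tuning parameters a and η. -/
noncomputable def hSCAD (a η x : ℝ) : ℝ :=
  if |x| ≤ 2 * η then Real.sign x * max (|x| - η) 0
  else if |x| ≤ a * η then ((a - 1) * x - Real.sign x * a * η) / (a - 2)
  else x

/-- The SCAD map g(x, w), with thresholds scaled by w. -/
noncomputable def gSCAD (a η : ℝ) (x w : ℝ) : ℝ := hSCAD a (w * η) x

/-- The function b(w; m, k, θ) (for given t > 0). -/
noncomputable def bFun (t k θ w : ℝ) : ℝ :=
  if max (-(t * w)) (-(k * w) - θ) ≥ min (t * w) (k * w - θ) then 0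
  else Phi (min (t * w) (k * w - θ)) - Phi (max (-(t * w)) (-(k * w) - θ))

theorem phi_eq_gaussianPDFReal : phi = ProbabilityTheory.gaussianPDFReal 0 1 := by
  ext x
  simp [phi, ProbabilityTheory.gaussianPDFReal]

theorem phi_nonneg (x : ℝ) : 0 ≤ phi x := by
  unfold phi
  positivity

theorem continuous_phi : Continuous phi := by
  unfold phi
  fun_prop

theorem integrable_phi : Integrable phi := by
  rw [phi_eq_gaussianPDFReal]
  exact ProbabilityTheory.integrable_gaussianPDFReal 0 1

theorem integral_phi : ∫ x, phi x = 1 := by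
  rw [phi_eq_gaussianPDFReal]
  exact ProbabilityTheory.integral_gaussianPDFReal_eq_one 0 one_ne_zero

theorem Phi_sub_Phi {a b : ℝ} (hab : a ≤ b) : Phi b - Phi a = ∫ x in Ioc a b, phi x := by
  rw [← intervalIntegral.integral_of_le hab]
  exact intervalIntegral.integral_Iic_sub_Iic integrable_phi.integrableOn integrable_phi.integrableOn

theorem monotone_Phi : Monotone Phi := fun a b hab => by
  have h : 0 ≤ ∫ x in Ioc a b, phi x := integral_nonneg phi_nonneg
  rw [← Phi_sub_Phi hab] at h
  linarith

theorem Phi_nonneg (x : ℝ) : 0 ≤ Phi x := integral_nonneg phi_nonneg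

theorem Phi_le_one (x : ℝ) : Phi x ≤ 1 := by
  rw [← integral_phi]
  exact setIntegral_le_integral integrable_phi (Eventually.of_forall phi_nonneg)

theorem abs_Phi_sub_Phi_le_one (x y : ℝ) : |Phi x - Phi y| ≤ 1 := by
  rw [abs_le]
  constructor <;> linarith [Phi_nonneg x, Phi_nonneg y, Phi_le_one x, Phi_le_one y]

theorem measurable_fW (m : ℕ) : Measurable (fW m) := by
  unfold fW
  fun_prop

theorem fW_nonneg (m : ℕ) {w : ℝ} (hw : 0 ≤ w) : 0 ≤ fW m w := by
  unfold fW
  have : 0 ≤ Real.Gamma ((m : ℝ) / 2) := Real.Gamma_nonneg_of_nonneg (by positivity)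
  positivity

theorem integrableOn_fW {m : ℕ} (hm : 0 < m) : IntegrableOn (fW m) (Ioi 0) := by
  have hm' : (0 : ℝ) < m := by exact_mod_cast hm
  have h := (integrableOn_rpow_mul_exp_neg_mul_sq (b := (m : ℝ) / 2) (s := (m : ℝ) - 1)
    (by positivity) (by linarith)).const_mul
    (2 * (m : ℝ) ^ ((m : ℝ) / 2) / (Real.Gamma ((m : ℝ) / 2) * (2 : ℝ) ^ ((m : ℝ) / 2)))
  refine IntegrableOn.congr_fun h (fun w _ => ?_) measurableSet_Ioi
  have hexp : -(m : ℝ) * w ^ 2 / 2 = -((m : ℝ) / 2) * w ^ 2 := by ring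
  rw [fW, hexp, mul_assoc]

theorem integrableOn_mul_fW {m : ℕ} (hm : 0 < m) {f : ℝ → ℝ} (hf : Measurable f)
    (hf_le : ∀ w, |f w| ≤ 1) : IntegrableOn (fun w => f w * fW m w) (Ioi 0) :=
  (integrableOn_fW hm).bdd_mul hf.aestronglyMeasurable (Eventually.of_forall hf_le)

theorem integral_comp_mul_sub_mul (f : ℝ → ℝ) {w : ℝ} (hw : 0 < w) (θ : ℝ) :
    ∫ x, f (w * x - θ) * w = ∫ z, f z := by
  rw [integral_mul_const, Measure.integral_comp_mul_left (fun y => f (y - θ)) w,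
    integral_sub_right_eq_self f θ, abs_of_pos (inv_pos.2 hw), smul_eq_mul]
  field_simp

theorem measurable_sign : Measurable Real.sign := by
  unfold Real.sign
  exact Measurable.ite measurableSet_Iio measurable_const
    (Measurable.ite measurableSet_Ioi measurable_const measurable_const)

theorem measurable_hSCAD (a η : ℝ) : Measurable (hSCAD a η) := by
  have := measurable_sign
  unfold hSCAD
  refine Measurable.ite (measurableSet_le (by fun_prop) (by fun_prop)) (by fun_prop)
    (Measurable.ite (measurableSet_le (by fun_prop) (by fun_prop)) (by fun_prop) (by fun_prop))

theorem sign_mul_of_pos {w : ℝ} (hw : 0 < w) (x : ℝ) : Real.sign (w * x) = Real.sign x := by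
  rcases lt_trichotomy x 0 with h | h | h
  · rw [Real.sign_of_neg h, Real.sign_of_neg (mul_neg_of_pos_of_neg hw h)]
  · simp [h]
  · rw [Real.sign_of_pos h, Real.sign_of_pos (mul_pos hw h)]

theorem gSCAD_mul (a η : ℝ) {w : ℝ} (hw : 0 < w) (x : ℝ) :
    gSCAD a η (w * x) w = w * hSCAD a η x := by
  have h1 : |w * x| ≤ 2 * (w * η) ↔ |x| ≤ 2 * η := by
    rw [abs_mul, abs_of_pos hw, mul_left_comm, mul_le_mul_iff_right₀ hw]
  have h2 : |w * x| ≤ a * (w * η) ↔ |x| ≤ a * η := by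
    rw [abs_mul, abs_of_pos hw, mul_left_comm, mul_le_mul_iff_right₀ hw]
  have h3 : max (|w * x| - w * η) 0 = w * max (|x| - η) 0 := by
    rw [mul_max_of_nonneg _ _ hw.le, abs_mul, abs_of_pos hw, mul_sub, mul_zero]
  simp only [gSCAD, hSCAD, h1, h2, h3, sign_mul_of_pos hw]
  split_ifs <;> ring

/-- The coverage integrand after the substitution `u = w * x`. -/
noncomputable def scaledIntegrand (m : ℕ) (η θ : ℝ) (s : ℝ → ℝ) (w x : ℝ) : ℝ :=
  (if hSCAD 3.7 η x - s |x| ≤ θ / w ∧ θ / w ≤ hSCAD 3.7 η x + s |x|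
    then (1 : ℝ) else 0) * phi (w * x - θ) * w * fW m w

theorem integral_coverage_eq_integral_scaledIntegrand (m : ℕ) (η θ : ℝ) (s : ℝ → ℝ) {w : ℝ}
    (hw : 0 < w) :
    (∫ u : ℝ, (if gSCAD 3.7 η u w - w * s (|u| / w) ≤ θ ∧
          θ ≤ gSCAD 3.7 η u w + w * s (|u| / w) then (1 : ℝ) else 0) * phi (u - θ) * fW m w) =
      ∫ x, scaledIntegrand m η θ s w x := by
  have h := integral_comp_mul_sub_mul (fun u => (if gSCAD 3.7 η u w - w * s (|u| / w) ≤ θ ∧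
    θ ≤ gSCAD 3.7 η u w + w * s (|u| / w) then (1 : ℝ) else 0) * phi (u - θ) * fW m w) hw 0
  simp only [sub_zero] at h
  rw [← h]
  congr 1 with x
  have h1 : |w * x| / w = |x| := by
    rw [abs_mul, abs_of_pos hw, mul_div_cancel_left₀ _ hw.ne']
  have h2 : (w * hSCAD 3.7 η x - w * s |x| ≤ θ ∧ θ ≤ w * hSCAD 3.7 η x + w * s |x|) ↔
      (hSCAD 3.7 η x - s |x| ≤ θ / w ∧ θ / w ≤ hSCAD 3.7 η x + s |x|) := by
    rw [le_div_iff₀' hw, div_le_iff₀' hw, mul_sub, mul_add]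
  simp only [scaledIntegrand, gSCAD_mul _ _ hw, h1, h2]
  ring

theorem measurable_scaledIntegrand (m : ℕ) (η θ : ℝ) {s : ℝ → ℝ} (hs : ContinuousOn s (Ici 0)) :
    Measurable (Function.uncurry (scaledIntegrand m η θ s)) := by
  have hs' : Measurable fun p : ℝ × ℝ => s |p.2| :=
    (hs.comp_continuous continuous_abs fun x => abs_nonneg x).measurable.comp measurable_snd
  have hh : Measurable fun p : ℝ × ℝ => hSCAD 3.7 η p.2 :=
    (measurable_hSCAD _ _).comp measurable_snd
  have hf := measurable_fW m
  have hphi := continuous_phi.measurable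
  have hset : MeasurableSet {p : ℝ × ℝ | hSCAD 3.7 η p.2 - s |p.2| ≤ θ / p.1 ∧
      θ / p.1 ≤ hSCAD 3.7 η p.2 + s |p.2|} := by
    rw [ofPred_and]
    exact (measurableSet_le (hh.sub hs') (by fun_prop)).inter
      (measurableSet_le (by fun_prop) (hh.add hs'))
  unfold Function.uncurry scaledIntegrand
  refine (((Measurable.ite hset measurable_const measurable_const).mul ?_).mul ?_).mul ?_ <;>
    fun_prop

theorem abs_scaledIntegrand_le (m : ℕ) (η θ : ℝ) (s : ℝ → ℝ) {w : ℝ} (hw : 0 < w) (x : ℝ) :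
    |scaledIntegrand m η θ s w x| ≤ phi (w * x - θ) * w * fW m w := by
  have h : 0 ≤ phi (w * x - θ) * w * fW m w :=
    mul_nonneg (mul_nonneg (phi_nonneg _) hw.le) (fW_nonneg m hw.le)
  unfold scaledIntegrand
  split_ifs
  · rw [one_mul, abs_of_nonneg h]
  · simpa using h

theorem integrable_comp_mul_sub {f : ℝ → ℝ} (hf : Integrable f) {w : ℝ} (hw : 0 < w) (θ : ℝ) :
    Integrable fun x => f (w * x - θ) :=
  (hf.comp_sub_right θ).comp_mul_left' hw.ne'

theorem integrable_scaledIntegrand {m : ℕ} (hm : 0 < m) (η θ : ℝ) {s : ℝ → ℝ}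
    (hs : ContinuousOn s (Ici 0)) :
    Integrable (Function.uncurry (scaledIntegrand m η θ s))
      ((volume.restrict (Ioi 0)).prod volume) := by
  have hf := measurable_fW m
  have hphi := continuous_phi.measurable
  have hpos : ∀ᵐ w ∂(volume.restrict (Ioi (0 : ℝ))), 0 < w := ae_restrict_mem measurableSet_Ioi
  have hD : Integrable (fun p : ℝ × ℝ => phi (p.1 * p.2 - θ) * p.1 * fW m p.1)
      ((volume.restrict (Ioi 0)).prod volume) := by
    rw [integrable_prod_iff (Measurable.aestronglyMeasurable (by fun_prop))]
    constructor
    · filter_upwards [hpos] with w hw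
      exact ((integrable_comp_mul_sub integrable_phi hw θ).mul_const w).mul_const _
    · refine (integrableOn_fW hm).congr ?_
      filter_upwards [hpos] with w hw
      have h (x : ℝ) : ‖phi (w * x - θ) * w * fW m w‖ = phi (w * x - θ) * w * fW m w :=
        Real.norm_of_nonneg (mul_nonneg (mul_nonneg (phi_nonneg _) hw.le) (fW_nonneg m hw.le))
      simp only [h]
      rw [integral_mul_const, integral_comp_mul_sub_mul phi hw, integral_phi, one_mul]
  refine hD.mono' (measurable_scaledIntegrand m η θ hs).aestronglyMeasurable ?_
  filter_upwards [Measure.quasiMeasurePreserving_fst.ae hpos] with p hp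
  exact abs_scaledIntegrand_le m η θ s hp p.2

theorem integral_indicator_Icc_phi {t : ℝ} (ht : 0 ≤ t) :
    ∫ z, (Icc (-t) t).indicator phi z = Phi t - Phi (-t) := by
  rw [integral_indicator measurableSet_Icc, integral_Icc_eq_integral_Ioc,
    Phi_sub_Phi (by linarith)]

theorem setIntegral_indicator_Icc_phi (t k θ w : ℝ) :
    ∫ z in Ioc (-(k * w) - θ) (k * w - θ), (Icc (-(t * w)) (t * w)).indicator phi z =
      bFun t k θ w := by
  have hae : (Icc (-(t * w)) (t * w)).indicator phi =ᵐ[volume]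
      (Ioc (-(t * w)) (t * w)).indicator phi :=
    indicator_ae_eq_of_ae_eq_set Ioc_ae_eq_Icc.symm
  rw [integral_congr_ae (ae_restrict_of_ae hae), setIntegral_indicator measurableSet_Ioc,
    Ioc_inter_Ioc, sup_comm, inf_comm]
  unfold bFun
  split_ifs with h
  · rw [Ioc_eq_empty (not_lt.2 h)]
    simp
  · exact (Phi_sub_Phi (not_le.1 h).le).symm

theorem hSCAD_of_lt {a η x : ℝ} (ha : 2 ≤ a) (hη : 0 ≤ η) (hx : a * η < |x|) :
    hSCAD a η x = x := by
  have : 2 * η ≤ a * η := mul_le_mul_of_nonneg_right ha hη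
  rw [hSCAD, if_neg (by linarith), if_neg (by linarith)]

theorem scaledIntegrand_of_lt (m : ℕ) {η t w : ℝ} (hη : 0 ≤ η) (hw : 0 < w) {s : ℝ → ℝ} (θ : ℝ)
    (hs_t : ∀ x, 3.7 * η ≤ x → s x = t) {x : ℝ} (hx : 3.7 * η < |x|) :
    scaledIntegrand m η θ s w x =
      (Icc (-(t * w)) (t * w)).indicator phi (w * x - θ) * w * fW m w := by
  have h : (x - t ≤ θ / w ∧ θ / w ≤ x + t) ↔ w * x - θ ∈ Icc (-(t * w)) (t * w) := by
    rw [le_div_iff₀' hw, div_le_iff₀' hw, mem_Icc]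
    constructor <;> rintro ⟨h1, h2⟩ <;> constructor <;> linarith
  simp only [scaledIntegrand, hSCAD_of_lt (by norm_num) hη hx, hs_t _ hx.le, h, indicator_apply]
  split_ifs <;> simp

theorem integral_scaledIntegrand (m : ℕ) {η k t w : ℝ} (hη : 0 < η) (hk : k = 3.7 * η)
    (ht : 0 < t) (hw : 0 < w) {s : ℝ → ℝ} (hs : ContinuousOn s (Ici 0))
    (hs_t : ∀ x, k ≤ x → s x = t) (θ : ℝ) :
    ∫ x, scaledIntegrand m η θ s w x = (∫ x in Ioc (-k) k, scaledIntegrand m η θ s w x) +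
      ((Phi (t * w) - Phi (-(t * w))) * fW m w - bFun t k θ w * fW m w) := by
  set ψ : ℝ → ℝ := (Icc (-(t * w)) (t * w)).indicator phi
  set G : ℝ → ℝ := fun x => ψ (w * x - θ) * w * fW m w with hG
  have hF : Integrable (scaledIntegrand m η θ s w) :=
    (((integrable_comp_mul_sub integrable_phi hw θ).mul_const w).mul_const (fW m w)).mono'
      ((measurable_scaledIntegrand m η θ hs).comp measurable_prodMk_left).aestronglyMeasurable
      (Eventually.of_forall (abs_scaledIntegrand_le m η θ s hw))
  have hGi : Integrable G := ((integrable_comp_mul_sub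
    (integrable_phi.indicator measurableSet_Icc) hw θ).mul_const w).mul_const (fW m w)
  have h_compl : ∫ x in (Ioc (-k) k)ᶜ, scaledIntegrand m η θ s w x = ∫ x in (Ioc (-k) k)ᶜ, G x := by
    refine setIntegral_congr_ae measurableSet_Ioc.compl ?_
    filter_upwards [Measure.ae_ne volume (-k)] with x hx_ne hx
    refine scaledIntegrand_of_lt m hη.le hw θ (hk ▸ hs_t) (hk ▸ lt_abs.2 ?_)
    by_contra! h
    exact hx ⟨lt_of_le_of_ne (by linarith) hx_ne.symm, h.1⟩
  have h_all : ∫ x, G x = (Phi (t * w) - Phi (-(t * w))) * fW m w := by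
    rw [hG, integral_mul_const, integral_comp_mul_sub_mul ψ hw,
      integral_indicator_Icc_phi (by positivity)]
  have h_mid : ∫ x in Ioc (-k) k, G x = bFun t k θ w * fW m w := by
    have h := integral_comp_mul_sub_mul ((Ioc (-(k * w) - θ) (k * w - θ)).indicator ψ) hw θ
    rw [integral_indicator measurableSet_Ioc, setIntegral_indicator_Icc_phi] at h
    rw [← h, ← integral_indicator measurableSet_Ioc, ← integral_mul_const]
    congr 1 with x
    have hx : w * x - θ ∈ Ioc (-(k * w) - θ) (k * w - θ) ↔ x ∈ Ioc (-k) k := by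
      rw [mem_Ioc, mem_Ioc, sub_lt_sub_iff_right, sub_le_sub_iff_right, ← neg_mul, mul_comm k w,
        mul_comm (-k) w, mul_lt_mul_iff_right₀ hw, mul_le_mul_iff_right₀ hw]
    simp only [indicator_apply, hx, hG]
    split_ifs <;> simp
  have h1 := integral_add_compl (measurableSet_Ioc (a := -k) (b := k)) hF
  have h2 := integral_add_compl (measurableSet_Ioc (a := -k) (b := k)) hGi
  linarith

theorem measurable_bFun (t k θ : ℝ) : Measurable (bFun t k θ) := by
  have := monotone_Phi.measurable
  unfold bFun
  exact Measurable.ite (measurableSet_le (by fun_prop) (by fun_prop)) measurable_const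
    (by fun_prop)

theorem abs_bFun_le_one (t k θ w : ℝ) : |bFun t k θ w| ≤ 1 := by
  unfold bFun
  split_ifs
  · simp
  · exact abs_Phi_sub_Phi_le_one _ _

theorem coverage_probability_formula (m : ℕ) (hm : 0 < m) (η k t α : ℝ)
    (hη : 0 < η) (hk : k = 3.7 * η) (hα : α ∈ Set.Ioo (0 : ℝ) 1) (ht : 0 < t)
    (htα : (∫ w in Set.Ioi (0 : ℝ), (Phi (t * w) - Phi (-(t * w))) * fW m w) = 1 - α)
    (s : ℝ → ℝ) (hs_cont : ContinuousOn s (Set.Ici 0))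
    (hs_pos : ∀ x, 0 ≤ x → 0 < s x) (hs_t : ∀ x, k ≤ x → s x = t) (θ : ℝ) :
    (∫ w in Set.Ioi (0 : ℝ), ∫ u : ℝ,
        (if gSCAD 3.7 η u w - w * s (|u| / w) ≤ θ ∧ θ ≤ gSCAD 3.7 η u w + w * s (|u| / w)
          then (1 : ℝ) else 0) * phi (u - θ) * fW m w) =
      (∫ x in (-k)..k, ∫ w in Set.Ioi (0 : ℝ),
        (if hSCAD 3.7 η x - s |x| ≤ θ / w ∧ θ / w ≤ hSCAD 3.7 η x + s |x|
          then (1 : ℝ) else 0) * phi (w * x - θ) * w * fW m w)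
      + (1 - α) - ∫ w in Set.Ioi (0 : ℝ), bFun t k θ w * fW m w := by
  have hk0 : -k ≤ k := by rw [hk]; linarith
  have hPhi := monotone_Phi.measurable
  have hF := integrable_scaledIntegrand hm η θ hs_cont
  have hF' : Integrable (Function.uncurry (scaledIntegrand m η θ s))
      ((volume.restrict (Ioi 0)).prod (volume.restrict (Ioc (-k) k))) :=
    hF.mono_measure (Measure.prod_mono le_rfl Measure.restrict_le_self)
  have hΦ : IntegrableOn (fun w => (Phi (t * w) - Phi (-(t * w))) * fW m w) (Ioi 0) :=
    integrableOn_mul_fW hm (by fun_prop) fun w => abs_Phi_sub_Phi_le_one _ _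
  have hb : IntegrableOn (fun w => bFun t k θ w * fW m w) (Ioi 0) :=
    integrableOn_mul_fW hm (measurable_bFun t k θ) (abs_bFun_le_one t k θ)
  calc
    _ = ∫ w in Ioi (0 : ℝ), ((∫ x in Ioc (-k) k, scaledIntegrand m η θ s w x) +
          ((Phi (t * w) - Phi (-(t * w))) * fW m w - bFun t k θ w * fW m w)) :=
      setIntegral_congr_fun measurableSet_Ioi fun w hw =>
        (integral_coverage_eq_integral_scaledIntegrand m η θ s hw).trans
          (integral_scaledIntegrand m hη hk ht hw hs_cont hs_t θ)
    _ = (∫ w in Ioi (0 : ℝ), ∫ x in Ioc (-k) k, scaledIntegrand m η θ s w x) +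
          ((1 - α) - ∫ w in Ioi (0 : ℝ), bFun t k θ w * fW m w) := by
      rw [← htα, ← integral_sub hΦ hb]
      exact integral_add hF'.integral_prod_left (hΦ.sub hb)
    _ = _ := by
      rw [integral_integral_swap hF', intervalIntegral.integral_of_le hk0, add_sub_assoc]
      rfl
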